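/- arXiv:0909.1175 — 2 statements merged into one kernel-verified Lean document; each statement's English description precedes it below -/
import Mathlib

section
/- Let q be an odd prime power and ψ a nontrivial additive character of F_q. Define the Kloosterman sum for GL(t,q) by K_{GL(t,q)}(ψ;a) = Σ_{w∈GL(t,q)} ψ(Tr w + a·Tr w⁻¹), with K_{GL(0,q)}(ψ;a) = 1. Then for all integers t ≥ 2 and a ∈ F_q*, K_{GL(t,q)}(ψ;a) = q^{t-1}·K_{GL(t-1,q)}(ψ;a)·K(ψ;a) + q^{2t-2}(q^{t-1}-1)·K_{GL(t-2,q)}(ψ;a), where K(ψ;a) = K_{GL(1,q)}(ψ;a) is the ordinary Kloosterman sum. -/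
open Finset Matrix

/-- The Kloosterman sum `K(ψ;a) = ∑_{α ∈ F*} ψ(α + a α⁻¹)`. -/
noncomputable def Kl {F : Type} [Field F] [Fintype F] [DecidableEq F] (ψ : F → ℂ) (a : F) : ℂ :=
  ∑ α : Fˣ, ψ ((α : F) + a * (α : F)⁻¹)

/-- The Kloosterman sum for `GL(t,q)`:
`K_{GL(t,q)}(ψ;a) = ∑_{w ∈ GL(t,q)} ψ(Tr w + a · Tr w⁻¹)`. -/
noncomputable def KlGL {F : Type} [Field F] [Fintype F] [DecidableEq F]
    (t : ℕ) (ψ : F → ℂ) (a : F) : ℂ :=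
  ∑ w : GL (Fin t) F,
    ψ (Matrix.trace (w : Matrix (Fin t) (Fin t) F)
        + a * Matrix.trace ((w⁻¹ : GL (Fin t) F) : Matrix (Fin t) (Fin t) F))

namespace GLKloosterman

/-- `Fin (n + 1)` is a point together with `Fin n`. -/
def finSuccEquivSum (n : ℕ) : Fin (n + 1) ≃ Unit ⊕ Fin n :=
  (finSuccEquiv n).trans ((Equiv.optionEquivSumPUnit _).trans (Equiv.sumComm _ _))

section

variable {F : Type} [Field F] {ι κ p r : Type*} [Fintype ι] [Fintype κ] [Fintype p] [Fintype r]

lemma trace_fromBlocks (A : Matrix p p F) (B : Matrix p r F) (C : Matrix r p F)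
    (D : Matrix r r F) : trace (fromBlocks A B C D) = trace A + trace D := by
  simp [trace, Fintype.sum_sum_type]

variable [DecidableEq ι] [DecidableEq κ] [DecidableEq p] [DecidableEq r]

/-- The summand `ψ(Tr w + a · Tr w⁻¹)` of the Kloosterman sum. -/
noncomputable def summand (ψ : AddChar F ℂ) (a : F) (w : GL ι F) : ℂ :=
  ψ (trace w.val + a * trace w⁻¹.val)

/-- Reindexing of the general linear group along a bijection of index types. -/
def reindexGL (e : ι ≃ κ) : GL ι F ≃* GL κ F :=
  Units.mapEquiv (reindexAlgEquiv F F e).toMulEquiv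

lemma reindexGL_apply (e : ι ≃ κ) (w : GL ι F) (i j : κ) :
    (reindexGL e w).val i j = w.val (e.symm i) (e.symm j) := rfl

lemma reindexGL_inv_apply (e : ι ≃ κ) (w : GL ι F) (i j : κ) :
    (reindexGL e w)⁻¹.val i j = w⁻¹.val (e.symm i) (e.symm j) := rfl

lemma summand_reindexGL (ψ : AddChar F ℂ) (a : F) (e : ι ≃ κ) (w : GL ι F) :
    summand ψ a (reindexGL e w) = summand ψ a w := by
  have h1 : trace (reindexGL e w).val = trace w.val :=
    Equiv.sum_comp e.symm fun i => w.val i i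
  have h2 : trace (reindexGL e w)⁻¹.val = trace w⁻¹.val :=
    Equiv.sum_comp e.symm fun i => w⁻¹.val i i
  rw [summand, summand, h1, h2]

lemma summand_conj (ψ : AddChar F ℂ) (a : F) (g w : GL ι F) :
    summand ψ a (g * w * g⁻¹) = summand ψ a w := by
  have h1 : trace (g * w * g⁻¹).val = trace w.val := by
    rw [Units.val_mul, trace_mul_comm, ← Units.val_mul, inv_mul_cancel_left]
  have h2 : trace (g * w * g⁻¹)⁻¹.val = trace w⁻¹.val := by
    rw [_root_.mul_inv_rev, _root_.mul_inv_rev, inv_inv, Units.val_mul, trace_mul_comm,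
      ← Units.val_mul, mul_assoc, inv_mul_cancel, mul_one]
  rw [summand, summand, h1, h2]

/-- The block upper triangular matrix with invertible diagonal blocks `A` and `D`. -/
def blockGL (A : GL p F) (D : GL r F) (B : Matrix p r F) : GL (p ⊕ r) F where
  val := fromBlocks A.val B 0 D.val
  inv := fromBlocks A⁻¹.val (-(A⁻¹.val * B * D⁻¹.val)) 0 D⁻¹.val
  val_inv := by
    have hA : A.val * A⁻¹.val = 1 := A.mul_inv
    have hD : D.val * D⁻¹.val = 1 := D.mul_inv
    rw [fromBlocks_multiply]
    simp only [Matrix.mul_zero, Matrix.zero_mul, add_zero, zero_add, Matrix.mul_neg,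
      ← Matrix.mul_assoc, hA, hD, Matrix.one_mul, neg_add_cancel, neg_zero, fromBlocks_one]
  inv_val := by
    have hA : A⁻¹.val * A.val = 1 := A.inv_mul
    have hD : D⁻¹.val * D.val = 1 := D.inv_mul
    rw [fromBlocks_multiply]
    simp only [Matrix.mul_zero, Matrix.zero_mul, add_zero, zero_add, Matrix.neg_mul,
      Matrix.mul_assoc, hA, hD, Matrix.mul_one, add_neg_cancel, fromBlocks_one]

lemma blockGL_val (A : GL p F) (D : GL r F) (B : Matrix p r F) :
    (blockGL A D B).val = fromBlocks A.val B 0 D.val := rfl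

lemma blockGL_inv_val (A : GL p F) (D : GL r F) (B : Matrix p r F) :
    (blockGL A D B)⁻¹.val = fromBlocks A⁻¹.val (-(A⁻¹.val * B * D⁻¹.val)) 0 D⁻¹.val := rfl

lemma summand_blockGL (ψ : AddChar F ℂ) (a : F) (A : GL p F) (D : GL r F) (B : Matrix p r F) :
    summand ψ a (blockGL A D B) = summand ψ a A * summand ψ a D := by
  rw [summand, summand, summand, ← AddChar.map_add_eq_mul, blockGL_val, blockGL_inv_val,
    trace_fromBlocks, trace_fromBlocks]
  congr 1
  ring

lemma exists_blockGL (w : GL (p ⊕ r) F) (hw : w.val.toBlocks₂₁ = 0) :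
    ∃ A D B, blockGL A D B = w := by
  have h := fromBlocks_toBlocks w.val
  rw [hw] at h
  have hu : IsUnit (fromBlocks w.val.toBlocks₁₁ w.val.toBlocks₁₂ 0 w.val.toBlocks₂₂) :=
    h ▸ w.isUnit
  obtain ⟨⟨A, hA⟩, ⟨D, hD⟩⟩ := isUnit_fromBlocks_zero₂₁.mp hu
  refine ⟨A, D, w.val.toBlocks₁₂, Units.ext ?_⟩
  rw [blockGL_val, hA, hD, h]

/-- The lower part of the first column. -/
def lowerCol (M : Matrix (Unit ⊕ r) (Unit ⊕ r) F) : r → F := fun j => M (Sum.inr j) (Sum.inl ())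

lemma summand_mul_blockGL_one (ψ : AddChar F ℂ) (a : F) (w : GL (Unit ⊕ r) F) (x : r → F) :
    summand ψ a (w * blockGL 1 1 (replicateRow Unit x))
      = summand ψ a w * ψ (∑ j, x j * (lowerCol w.val - a • lowerCol w⁻¹.val) j) := by
  rw [summand, summand, ← AddChar.map_add_eq_mul, _root_.mul_inv_rev, Units.val_mul, Units.val_mul,
    blockGL_val, blockGL_inv_val]
  have hs : ∑ j, x j * (lowerCol w.val - a • lowerCol w⁻¹.val) j
      = ∑ j, x j * w.val (Sum.inr j) (Sum.inl ())
        - a * ∑ j, x j * w⁻¹.val (Sum.inr j) (Sum.inl ()) := by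
    rw [Finset.mul_sum, ← Finset.sum_sub_distrib]
    refine Finset.sum_congr rfl fun j _ => ?_
    change x j * (_ - a * _) = _
    rw [mul_sub, mul_left_comm]
    rfl
  rw [hs]
  congr 1
  simp only [trace, diag_apply, mul_apply, Fintype.sum_sum_type]
  simp [Matrix.one_apply, Finset.sum_add_distrib]
  simp only [mul_comm]
  ring

lemma exists_GL_mulVec_eq (v v' : r → F) (hv : v ≠ 0) (hv' : v' ≠ 0) :
    ∃ g : GL r F, g.val *ᵥ v = v' := by
  let f := (LinearEquiv.toSpanNonzeroSingleton F _ v hv).symm ≪≫ₗ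
    LinearEquiv.toSpanNonzeroSingleton F _ v' hv'
  obtain ⟨g, hg⟩ := Submodule.exists_linearEquiv_restrict_eq f
  have hgv : g v = v' := by
    have h := hg (LinearEquiv.toSpanNonzeroSingleton F _ v hv 1)
    rw [LinearEquiv.trans_apply, LinearEquiv.symm_apply_apply] at h
    simpa using h.symm
  refine ⟨GeneralLinearGroup.toLin.symm
    (LinearMap.GeneralLinearGroup.ofLinearEquiv g), ?_⟩
  rw [← hgv]
  exact LinearMap.toMatrix'_mulVec g.toLinearMap v

lemma lowerCol_conj (g : GL r F) (w : GL (Unit ⊕ r) F) :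
    lowerCol (blockGL 1 g 0 * w * (blockGL 1 g 0)⁻¹).val = g.val *ᵥ lowerCol w.val := by
  ext j
  rw [Units.val_mul, Units.val_mul, blockGL_val, blockGL_inv_val]
  simp [lowerCol, mul_apply, mulVec, dotProduct, Fintype.sum_sum_type]

lemma lowerCol_inv_eq_zero (w : GL (Unit ⊕ r) F) (hw : lowerCol w.val = 0) :
    lowerCol w⁻¹.val = 0 := by
  have hz : ∀ j, w.val (Sum.inr j) (Sum.inl ()) = 0 := fun j => congrFun hw j
  have h : ∀ i, w⁻¹.val i (Sum.inl ()) * w.val (Sum.inl ()) (Sum.inl ())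
      = (1 : Matrix (Unit ⊕ r) (Unit ⊕ r) F) i (Sum.inl ()) := by
    intro i
    rw [← show w⁻¹.val * w.val = 1 from w.inv_mul, mul_apply, Fintype.sum_sum_type]
    simp [hz]
  have h0 : w.val (Sum.inl ()) (Sum.inl ()) ≠ 0 := by
    intro h0
    simpa [h0] using h (Sum.inl ())
  ext j
  have hj := h (Sum.inr j)
  rw [one_apply_ne Sum.inr_ne_inl, mul_eq_zero] at hj
  exact hj.resolve_right h0

/-- The shape of a `2 × 2` block in the complement of the parabolic subgroup. -/
def IsCell (a : F) (A : Matrix (Unit ⊕ Unit) (Unit ⊕ Unit) F) : Prop :=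
  A (Sum.inr ()) (Sum.inl ()) = 1 ∧
    A (Sum.inl ()) (Sum.inr ())
      = A (Sum.inl ()) (Sum.inl ()) * A (Sum.inr ()) (Sum.inr ()) + a

/-- The element of `GL₂` with diagonal `α, δ` satisfying `IsCell`. -/
def cellGL (a : F) (ha : a ≠ 0) (α δ : F) : GL (Unit ⊕ Unit) F where
  val := fromBlocks (of fun _ _ => α) (of fun _ _ => α * δ + a) (of fun _ _ => 1) (of fun _ _ => δ)
  inv := fromBlocks (of fun _ _ => -(δ / a)) (of fun _ _ => (α * δ + a) / a)
    (of fun _ _ => 1 / a) (of fun _ _ => -(α / a))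
  val_inv := by
    rw [fromBlocks_multiply, ← fromBlocks_one]
    congr 1 <;> ext i j <;> simp [mul_apply] <;> field_simp <;> ring
  inv_val := by
    rw [fromBlocks_multiply, ← fromBlocks_one]
    congr 1 <;> ext i j <;> simp [mul_apply] <;> field_simp <;> ring

lemma summand_cellGL (ψ : AddChar F ℂ) (a : F) (ha : a ≠ 0) (α δ : F) :
    summand ψ a (cellGL a ha α δ) = 1 := by
  have h : trace (cellGL a ha α δ).val + a * trace (cellGL a ha α δ)⁻¹.val = 0 := by
    change trace (fromBlocks _ _ _ _) + a * trace (fromBlocks _ _ _ _) = 0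
    rw [trace_fromBlocks, trace_fromBlocks]
    simp [trace]
    field_simp
    ring
  rw [summand, h, AddChar.map_zero_eq_one]

lemma isCell_iff (a : F) (ha : a ≠ 0) (w : GL ((Unit ⊕ Unit) ⊕ r) F) :
    (w.val.toBlocks₂₁ = 0 ∧ IsCell a w.val.toBlocks₁₁) ↔
      (w.val (Sum.inl (Sum.inr ())) (Sum.inl (Sum.inl ())) = 1 ∧
        ∀ k, w.val (Sum.inr k) (Sum.inl (Sum.inl ())) = 0) ∧
      (w.val (Sum.inl (Sum.inr ())) (Sum.inl (Sum.inl ()))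
          = a * w⁻¹.val (Sum.inl (Sum.inr ())) (Sum.inl (Sum.inl ())) ∧
        ∀ k, w.val (Sum.inr k) (Sum.inl (Sum.inl ()))
          = a * w⁻¹.val (Sum.inr k) (Sum.inl (Sum.inl ()))) := by
  have h1 : w.val * w⁻¹.val = 1 := w.mul_inv
  have h2 : w⁻¹.val * w.val = 1 := w.inv_mul
  generalize w.val = M at *
  generalize w⁻¹.val = N at *
  have e1 := fun i j => congrFun (congrFun h1 i) j
  have e2 := fun i j => congrFun (congrFun h2 i) j
  simp only [mul_apply, Fintype.sum_sum_type, Finset.univ_unique, Finset.sum_singleton,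
    PUnit.default_eq_unit] at e1 e2
  constructor
  · rintro ⟨hz, hc1, hc2⟩
    have hz' : ∀ k i, M (Sum.inr k) (Sum.inl i) = 0 := fun k i => congrFun (congrFun hz k) i
    simp only [toBlocks₁₁, of_apply] at hc1 hc2
    have f0 := fun i => e2 i (Sum.inl (Sum.inl ()))
    have f1 := fun i => e2 i (Sum.inl (Sum.inr ()))
    simp only [hz', mul_zero, Finset.sum_const_zero, add_zero, hc1, hc2, mul_one] at f0 f1
    refine ⟨⟨hc1, fun k => hz' k _⟩, ?_, fun k => ?_⟩
    · have g0 := f0 (Sum.inl (Sum.inr ()))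
      have g1 := f1 (Sum.inl (Sum.inr ()))
      simp at g0 g1
      rw [hc1]
      linear_combination M (Sum.inl (Sum.inr ())) (Sum.inl (Sum.inr ())) * g0 - g1
    · have g0 := f0 (Sum.inr k)
      have g1 := f1 (Sum.inr k)
      simp at g0 g1
      rw [hz']
      linear_combination M (Sum.inl (Sum.inr ())) (Sum.inl (Sum.inr ())) * g0 - g1
  · rintro ⟨⟨hc1, hz⟩, hn1, hn⟩
    have hN1 : N (Sum.inl (Sum.inr ())) (Sum.inl (Sum.inl ())) = a⁻¹ := by
      rw [hc1] at hn1
      exact (inv_eq_of_mul_eq_one_right hn1.symm).symm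
    have hN : ∀ k, N (Sum.inr k) (Sum.inl (Sum.inl ())) = 0 := by
      intro k
      have := hn k
      rw [hz, eq_comm, mul_eq_zero] at this
      exact this.resolve_left ha
    have f := fun i => e1 i (Sum.inl (Sum.inl ()))
    simp only [hN, hN1, mul_zero, Finset.sum_const_zero, add_zero] at f
    have g0 := f (Sum.inl (Sum.inl ()))
    have g1 := f (Sum.inl (Sum.inr ()))
    simp [hc1] at g0 g1
    refine ⟨?_, hc1, ?_⟩
    · ext k (i | i)
      · exact hz k
      · have := f (Sum.inr k)
        rw [hz, zero_mul, zero_add, one_apply_ne Sum.inr_ne_inl, mul_eq_zero] at this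
        exact this.resolve_right (inv_ne_zero ha)
    · simp only [toBlocks₁₁, of_apply]
      field_simp at g0 g1
      linear_combination g0 - M (Sum.inl (Sum.inl ())) (Sum.inl (Sum.inl ())) * g1

variable [Fintype F] [DecidableEq F]

/-- The Kloosterman sum over `GL ι F` for an arbitrary finite index type `ι`. -/
noncomputable def total (ι : Type*) [Fintype ι] [DecidableEq ι] (ψ : AddChar F ℂ) (a : F) : ℂ :=
  ∑ w : GL ι F, summand ψ a w

lemma total_congr (ψ : AddChar F ℂ) (a : F) (e : ι ≃ κ) : total ι ψ a = total κ ψ a :=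
  Fintype.sum_equiv (reindexGL e).toEquiv _ _ fun w => (summand_reindexGL ψ a e w).symm

open Classical in
/-- The part of the Kloosterman sum over a maximal parabolic subgroup, with a condition imposed
on the upper left block. -/
lemma sum_toBlocks₂₁_eq_zero (ψ : AddChar F ℂ) (a : F) (P : Matrix p p F → Prop) :
    (∑ w : GL (p ⊕ r) F,
        if w.val.toBlocks₂₁ = 0 ∧ P w.val.toBlocks₁₁ then summand ψ a w else 0)
      = (Fintype.card F : ℂ) ^ (Fintype.card p * Fintype.card r)
        * (∑ A : GL p F, if P A.val then summand ψ a A else 0) * total r ψ a := by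
  have key := Fintype.sum_of_injective
    (fun x : (GL p F × GL r F) × Matrix p r F => blockGL x.1.1 x.1.2 x.2)
    (by
      rintro ⟨⟨A, D⟩, B⟩ ⟨⟨A', D'⟩, B'⟩ h
      have h' := congrArg Units.val h
      simp only [blockGL_val, fromBlocks_inj] at h'
      simp only [Prod.mk.injEq]
      exact ⟨⟨Units.ext h'.1, Units.ext h'.2.2.2⟩, h'.2.1⟩)
    (fun x => (if P x.1.1.val then summand ψ a x.1.1 else 0) * summand ψ a x.1.2)
    (fun w : GL (p ⊕ r) F =>
      if w.val.toBlocks₂₁ = 0 ∧ P w.val.toBlocks₁₁ then summand ψ a w else 0)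
    (by
      intro w hw
      refine if_neg fun h => hw ?_
      obtain ⟨A, D, B, e⟩ := exists_blockGL w h.1
      exact ⟨((A, D), B), e⟩)
    (by
      rintro ⟨⟨A, D⟩, B⟩
      simp only [summand_blockGL, blockGL_val, toBlocks_fromBlocks₂₁, toBlocks_fromBlocks₁₁,
        true_and, ite_mul, zero_mul])
  rw [← key, Fintype.sum_prod_type]
  simp only [Finset.sum_const, Finset.card_univ, nsmul_eq_mul]
  rw [← Finset.mul_sum, Fintype.sum_prod_type, mul_assoc, total, Finset.sum_mul_sum]
  congr 1
  rw [Fintype.card_congr ((Matrix.of (m := p) (n := r) (α := F)).symm.trans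
    (Equiv.curry p r F).symm), Fintype.card_fun, Fintype.card_prod, Nat.cast_pow]

lemma sum_char_dotProduct (ψ : AddChar F ℂ) (hψ : ψ ≠ 1) (d : r → F) :
    ∑ x : r → F, ψ (∑ j, x j * d j)
      = if d = 0 then (Fintype.card F : ℂ) ^ Fintype.card r else 0 := by
  split_ifs with hd
  · simp [hd]
  obtain ⟨j, hj⟩ := Function.ne_iff.mp hd
  obtain ⟨c, hc⟩ := AddChar.ne_one_iff.mp hψ
  let φ : AddChar (r → F) ℂ :=
    { toFun := fun x => ψ (∑ j, x j * d j)
      map_zero_eq_one' := by simp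
      map_add_eq_mul' := fun x y => by
        simp only [Pi.add_apply, add_mul, Finset.sum_add_distrib, AddChar.map_add_eq_mul] }
  refine AddChar.sum_eq_zero_of_ne_one (ψ := φ) (AddChar.ne_one_iff.mpr ⟨Pi.single j (c / d j), ?_⟩)
  change ψ (∑ k, (Pi.single j (c / d j) : r → F) k * d k) ≠ 1
  rw [Finset.sum_eq_single j (fun k _ hk => by rw [Pi.single_eq_of_ne hk, zero_mul])
    (by simp), Pi.single_eq_same, div_mul_cancel₀ _ hj]
  exact hc

/-- Averaging over right translates by a unipotent radical. -/
lemma total_eq_sum_lowerCol (ψ : AddChar F ℂ) (hψ : ψ ≠ 1) (a : F) :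
    total (Unit ⊕ r) ψ a
      = ∑ w : GL (Unit ⊕ r) F,
          if lowerCol w.val = a • lowerCol w⁻¹.val then summand ψ a w else 0 := by
  have hq : (Fintype.card F : ℂ) ^ Fintype.card r ≠ 0 :=
    pow_ne_zero _ (Nat.cast_ne_zero.mpr Fintype.card_ne_zero)
  have h1 : ∑ x : r → F, ∑ w : GL (Unit ⊕ r) F,
      summand ψ a (w * blockGL 1 1 (replicateRow Unit x))
        = (Fintype.card F : ℂ) ^ Fintype.card r * total (Unit ⊕ r) ψ a := by
    have : ∀ x : r → F, ∑ w : GL (Unit ⊕ r) F,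
        summand ψ a (w * blockGL 1 1 (replicateRow Unit x)) = total (Unit ⊕ r) ψ a := fun x =>
      Equiv.sum_comp (Equiv.mulRight (blockGL 1 1 (replicateRow Unit x))) (summand ψ a)
    simp [this]
  refine mul_left_cancel₀ hq (h1.symm.trans ?_)
  rw [Finset.sum_comm, Finset.mul_sum]
  refine Finset.sum_congr rfl fun w _ => ?_
  simp only [summand_mul_blockGL_one]
  rw [← Finset.mul_sum, sum_char_dotProduct ψ hψ]
  simp only [sub_eq_zero]
  split_ifs <;> ring

/-- The part of the averaged Kloosterman sum with prescribed lower part of the first column. -/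
noncomputable def fibre (ψ : AddChar F ℂ) (a : F) (v : r → F) : ℂ :=
  ∑ w : GL (Unit ⊕ r) F,
    if lowerCol w.val = v ∧ lowerCol w.val = a • lowerCol w⁻¹.val then summand ψ a w else 0

lemma fibre_mulVec (ψ : AddChar F ℂ) (a : F) (g : GL r F) (v : r → F) :
    fibre ψ a (g.val *ᵥ v) = fibre ψ a v := by
  symm
  refine Fintype.sum_equiv (MulAut.conj (blockGL (1 : GL Unit F) g 0)).toEquiv _ _ fun w => ?_
  have hinj : Function.Injective (g.val.mulVec) :=
    Matrix.mulVec_injective_of_isUnit g.isUnit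
  have h2 : lowerCol (blockGL 1 g 0 * w * (blockGL 1 g 0)⁻¹)⁻¹.val
      = g.val *ᵥ lowerCol w⁻¹.val := by
    rw [← lowerCol_conj]
    rw [_root_.mul_inv_rev, _root_.mul_inv_rev, inv_inv, ← mul_assoc]
  change _ = if lowerCol (blockGL 1 g 0 * w * (blockGL 1 g 0)⁻¹).val = _ ∧
    lowerCol (blockGL 1 g 0 * w * (blockGL 1 g 0)⁻¹).val
      = a • lowerCol (blockGL 1 g 0 * w * (blockGL 1 g 0)⁻¹)⁻¹.val
    then summand ψ a (blockGL 1 g 0 * w * (blockGL 1 g 0)⁻¹) else 0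
  rw [h2, lowerCol_conj, summand_conj, ← mulVec_smul]
  simp only [hinj.eq_iff]

lemma total_eq_sum_fibre (ψ : AddChar F ℂ) (hψ : ψ ≠ 1) (a : F) :
    total (Unit ⊕ r) ψ a = ∑ v : r → F, fibre ψ a v := by
  rw [total_eq_sum_lowerCol ψ hψ]
  simp only [fibre]
  rw [Finset.sum_comm]
  refine Finset.sum_congr rfl fun w _ => ?_
  rw [Finset.sum_eq_single (lowerCol w.val)]
  · simp
  · intro v _ hv
    exact if_neg fun h => hv h.1.symm
  · simp

lemma total_eq_fibre_add (ψ : AddChar F ℂ) (hψ : ψ ≠ 1) (a : F) (e : r → F) (he : e ≠ 0) :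
    total (Unit ⊕ r) ψ a
      = fibre ψ a (0 : r → F)
        + ((Fintype.card F : ℂ) ^ Fintype.card r - 1) * fibre ψ a e := by
  rw [total_eq_sum_fibre ψ hψ, ← Finset.add_sum_erase _ _ (Finset.mem_univ (0 : r → F))]
  congr 1
  have : ∀ v ∈ Finset.univ.erase (0 : r → F), fibre ψ a v = fibre ψ a e := by
    intro v hv
    obtain ⟨g, rfl⟩ := exists_GL_mulVec_eq e v he (Finset.ne_of_mem_erase hv)
    exact fibre_mulVec ψ a g e
  rw [Finset.sum_congr rfl this, Finset.sum_const, Finset.card_erase_of_mem (Finset.mem_univ _),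
    nsmul_eq_mul, Nat.cast_sub (Finset.card_pos.mpr ⟨0, Finset.mem_univ _⟩)]
  simp

lemma fibre_zero (ψ : AddChar F ℂ) (a : F) :
    fibre ψ a (0 : r → F)
      = (Fintype.card F : ℂ) ^ Fintype.card r * total Unit ψ a * total r ψ a := by
  classical
  have h := sum_toBlocks₂₁_eq_zero (p := Unit) (r := r) ψ a fun _ => True
  simp only [and_true, if_true, Fintype.card_unit, one_mul] at h
  rw [total, ← h, fibre]
  refine Finset.sum_congr rfl fun w _ => if_congr ?_ rfl rfl
  constructor
  · rintro ⟨h, -⟩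
    ext j u
    exact congrFun h j
  · intro h
    have h' : lowerCol w.val = 0 := funext fun j => congrFun (congrFun h j) ()
    exact ⟨h', by rw [h', lowerCol_inv_eq_zero w h', smul_zero]⟩

open Classical in
lemma sum_isCell (ψ : AddChar F ℂ) (a : F) (ha : a ≠ 0) :
    (∑ A : GL (Unit ⊕ Unit) F, if IsCell a A.val then summand ψ a A else 0)
      = (Fintype.card F : ℂ) ^ 2 := by
  rw [← Fintype.sum_of_injective (fun x : F × F => cellGL a ha x.1 x.2) ?_ (fun _ => (1 : ℂ))
    _ ?_ ?_]
  · simp [sq]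
  · rintro ⟨α, δ⟩ ⟨α', δ'⟩ h
    have h' := congrArg Units.val h
    exact Prod.ext (congrFun (congrFun h' (Sum.inl ())) (Sum.inl ()))
      (congrFun (congrFun h' (Sum.inr ())) (Sum.inr ()))
  · intro A hA
    refine if_neg fun h => hA ⟨(A.val (Sum.inl ()) (Sum.inl ()), A.val (Sum.inr ()) (Sum.inr ())),
      Units.ext ?_⟩
    ext (i | i) (j | j)
    · rfl
    · exact h.2.symm
    · exact h.1.symm
    · rfl
  · rintro ⟨α, δ⟩
    rw [summand_cellGL, if_pos]
    exact ⟨rfl, rfl⟩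

lemma fibre_single (ψ : AddChar F ℂ) (a : F) (ha : a ≠ 0) :
    fibre ψ a (Pi.single (Sum.inl ()) 1 : Unit ⊕ r → F)
      = (Fintype.card F : ℂ) ^ (2 * Fintype.card r + 2) * total r ψ a := by
  classical
  have h := sum_toBlocks₂₁_eq_zero (r := r) ψ a (IsCell a)
  rw [sum_isCell ψ a ha, Fintype.card_sum, Fintype.card_unit, ← pow_add] at h
  rw [← h, fibre]
  refine Fintype.sum_equiv (reindexGL (Equiv.sumAssoc Unit Unit r).symm).toEquiv _ _ fun w => ?_
  change _ = if (reindexGL (Equiv.sumAssoc Unit Unit r).symm w).val.toBlocks₂₁ = 0 ∧ _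
    then summand ψ a (reindexGL (Equiv.sumAssoc Unit Unit r).symm w) else 0
  rw [summand_reindexGL]
  refine if_congr (Iff.trans ?_ (isCell_iff a ha _).symm) rfl rfl
  simp only [reindexGL_apply, reindexGL_inv_apply, funext_iff, Sum.forall, lowerCol,
    Pi.smul_apply, smul_eq_mul, Equiv.symm_symm, Equiv.sumAssoc_apply_inl_inl,
    Equiv.sumAssoc_apply_inl_inr, Equiv.sumAssoc_apply_inr, Pi.single_eq_same,
    Pi.single_eq_of_ne (Sum.inr_ne_inl), Unique.forall_iff, PUnit.default_eq_unit]

/-- The recursion for arbitrary index types. -/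
theorem total_recursion (ψ : AddChar F ℂ) (hψ : ψ ≠ 1) (a : F) (ha : a ≠ 0) :
    total (Unit ⊕ (Unit ⊕ r)) ψ a
      = (Fintype.card F : ℂ) ^ (Fintype.card r + 1) * total Unit ψ a * total (Unit ⊕ r) ψ a
        + ((Fintype.card F : ℂ) ^ (Fintype.card r + 1) - 1)
          * ((Fintype.card F : ℂ) ^ (2 * Fintype.card r + 2) * total r ψ a) := by
  rw [total_eq_fibre_add ψ hψ a (Pi.single (Sum.inl ()) 1 : Unit ⊕ r → F) (by simp),
    fibre_zero, fibre_single ψ a ha, Fintype.card_sum, Fintype.card_unit, add_comm 1]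

lemma Kl_eq_total (ψ : AddChar F ℂ) (a : F) : Kl ψ a = total Unit ψ a := by
  refine Fintype.sum_equiv
    (Units.mapEquiv (uniqueRingEquiv (m := Unit) (A := F)).symm.toMulEquiv).toEquiv _ _ fun α => ?_
  change ψ _ = ψ _
  rw [← Units.val_inv_eq_inv_val]
  congr 1
  simp [trace]

lemma KlGL_eq_total (ψ : AddChar F ℂ) (a : F) (t : ℕ) : KlGL t ψ a = total (Fin t) ψ a := rfl

end

end GLKloosterman

open GLKloosterman in
theorem stmt1 {F : Type} [Field F] [Fintype F] [DecidableEq F]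
    (hodd : Odd (Fintype.card F))
    (ψ : AddChar F ℂ) (hψ : ψ ≠ 1)
    (t : ℕ) (ht : 2 ≤ t) (a : F) (ha : a ≠ 0) :
    KlGL t ψ a
      = (Fintype.card F : ℂ) ^ (t - 1) * KlGL (t - 1) ψ a * Kl ψ a
        + (Fintype.card F : ℂ) ^ (2 * t - 2) * ((Fintype.card F : ℂ) ^ (t - 1) - 1)
            * KlGL (t - 2) ψ a := by
  obtain ⟨m, rfl⟩ := Nat.exists_eq_add_of_le' ht
  have h1 : m + 2 - 1 = m + 1 := rfl
  have h2 : m + 2 - 2 = m := rfl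
  have h3 : 2 * (m + 2) - 2 = 2 * m + 2 := rfl
  have e1 := finSuccEquivSum m
  have e2 := (finSuccEquivSum (m + 1)).trans (Equiv.sumCongr (Equiv.refl Unit) e1)
  rw [h1, h2, h3, KlGL_eq_total, KlGL_eq_total, KlGL_eq_total, Kl_eq_total,
    total_congr ψ a e1, total_congr ψ a e2, total_recursion ψ hψ a ha, Fintype.card_fin]
  ring
end

section
/- Let q = 3^r, ψ a nontrivial additive character of F_q, and for each positive integer r' let Ω_{r'} be the set of all r'×r' nonsingular symmetric matrices over F_q. Then a_{r'}(ψ) := Σ_{B∈Ω_{r'}} Σ_{h∈F_q^{r'×1}} ψ(ᵗh B h) equals q^{r'(r'+2)/4}·∏_{j=1}^{r'/2}(q^{2j-1}−1) if r' is even, and equals 0 if r' is odd. -/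
open Finset Matrix
open scoped Classical

section SymmetricCharacterSums

variable {F : Type} [Field F] [Fintype F]
variable {κ μ : Type} [Fintype κ] [DecidableEq κ] [Fintype μ] [DecidableEq μ]

/-- The character sum of the quadratic form attached to the matrix `B`. -/
noncomputable def quadSum (ψ : AddChar F ℂ) (B : Matrix κ κ F) : ℂ :=
  ∑ h : κ → F, ψ (h ⬝ᵥ B *ᵥ h)

/-- `quadSum ψ B` if `B` is symmetric and nonsingular, and `0` otherwise. -/
noncomputable def nondegQuadSum (ψ : AddChar F ℂ) (B : Matrix κ κ F) : ℂ :=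
  if B.IsSymm ∧ B.det ≠ 0 then quadSum ψ B else 0

variable (κ) in
/-- The sum of `quadSum ψ B` over all nonsingular symmetric matrices `B` indexed by `κ`. -/
noncomputable def totalQuadSum (ψ : AddChar F ℂ) : ℂ :=
  ∑ B : Matrix κ κ F, nondegQuadSum ψ B

variable (ψ : AddChar F ℂ)

theorem quadSum_submatrix (e : κ ≃ μ) (B : Matrix μ μ F) :
    quadSum ψ (B.submatrix e e) = quadSum ψ B := by
  refine Fintype.sum_equiv (e.arrowCongr (Equiv.refl F)) _ _ fun h => ?_
  rw [submatrix_mulVec_equiv]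
  congr 1
  simp only [dotProduct, Function.comp_apply, Equiv.arrowCongr_apply, Equiv.coe_refl, id]
  refine Fintype.sum_equiv e _ _ fun i => ?_
  rw [Equiv.symm_apply_apply]
  rfl

theorem nondegQuadSum_submatrix (e : κ ≃ μ) (B : Matrix μ μ F) :
    nondegQuadSum ψ (B.submatrix e e) = nondegQuadSum ψ B := by
  have hsymm : (B.submatrix e e).IsSymm ↔ B.IsSymm := by
    refine ⟨fun h => ?_, fun h => h.submatrix e⟩
    simpa using h.submatrix e.symm
  simp only [nondegQuadSum, hsymm, det_submatrix_equiv_self, quadSum_submatrix]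

theorem totalQuadSum_congr (e : κ ≃ μ) : totalQuadSum κ ψ = totalQuadSum μ ψ := by
  refine Fintype.sum_equiv (reindex e e) _ _ fun B => ?_
  rw [reindex_apply, nondegQuadSum_submatrix]

/-- Completing the square. -/
theorem quadSum_fromBlocks (A : Matrix μ μ F) (hA : A.IsSymm) (hdet : A.det ≠ 0)
    (B : Matrix μ κ F) (D : Matrix κ κ F) :
    quadSum ψ (fromBlocks A B Bᵀ (D + Bᵀ * A⁻¹ * B)) = quadSum ψ A * quadSum ψ D := by
  have hu : IsUnit A.det := hdet.isUnit
  unfold quadSum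
  rw [← (Equiv.sumArrowEquivProdArrow μ κ F).symm.sum_comp, Fintype.sum_prod_type_right,
    Finset.sum_mul_sum, Finset.sum_comm (s := univ) (t := univ) (f := fun x y => _ * _)]
  refine Finset.sum_congr rfl fun y _ => ?_
  rw [← (Equiv.subRight (A⁻¹ *ᵥ B *ᵥ y)).sum_comp]
  refine Finset.sum_congr rfl fun x _ => ?_
  rw [← AddChar.map_add_eq_mul]
  congr 1
  have h1 : A *ᵥ (A⁻¹ *ᵥ B *ᵥ y) = B *ᵥ y := by
    rw [mulVec_mulVec, mul_nonsing_inv _ hu, one_mulVec]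
  have h2 : (A⁻¹ *ᵥ B *ᵥ y) ⬝ᵥ (A *ᵥ x) = y ⬝ᵥ Bᵀ *ᵥ x := by
    rw [dotProduct_mulVec, ← mulVec_transpose, hA.eq, h1, dotProduct_comm, dotProduct_mulVec,
      ← mulVec_transpose, dotProduct_comm]
  change (Sum.elim (x - A⁻¹ *ᵥ B *ᵥ y) y) ⬝ᵥ
    (fromBlocks A B Bᵀ _ *ᵥ Sum.elim (x - A⁻¹ *ᵥ B *ᵥ y) y) = _
  rw [fromBlocks_mulVec, sumElim_dotProduct_sumElim]
  simp only [Sum.elim_comp_inl, Sum.elim_comp_inr, mulVec_sub, add_mulVec, h1, sub_add_cancel,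
    sub_dotProduct, dotProduct_add, dotProduct_sub, h2, ← mulVec_mulVec]
  ring

theorem nondegQuadSum_fromBlocks (A : Matrix μ μ F) (hA : A.IsSymm) (hdet : A.det ≠ 0)
    (B : Matrix μ κ F) (D : Matrix κ κ F) :
    nondegQuadSum ψ (fromBlocks A B Bᵀ (D + Bᵀ * A⁻¹ * B)) =
      quadSum ψ A * nondegQuadSum ψ D := by
  have hu : IsUnit A.det := hdet.isUnit
  have hS : (Bᵀ * A⁻¹ * B).IsSymm := by
    simp only [IsSymm, transpose_mul, transpose_transpose, transpose_nonsing_inv, hA.eq,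
      Matrix.mul_assoc]
  have hsymm : (fromBlocks A B Bᵀ (D + Bᵀ * A⁻¹ * B)).IsSymm ↔ D.IsSymm := by
    rw [isSymm_fromBlocks_iff]
    refine ⟨fun h => ?_, fun h => ⟨hA, rfl, transpose_transpose B, h.add hS⟩⟩
    simpa using h.2.2.2.sub hS
  have hd : (fromBlocks A B Bᵀ (D + Bᵀ * A⁻¹ * B)).det = A.det * D.det := by
    let := invertibleOfIsUnitDet A hu
    rw [det_fromBlocks₁₁, invOf_eq_nonsing_inv, add_sub_cancel_right]
  simp only [nondegQuadSum, hsymm, hd, mul_ne_zero_iff, hdet, quadSum_fromBlocks ψ A hA hdet,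
    ne_eq, not_false_eq_true, true_and, mul_ite, mul_zero]

theorem sum_nondegQuadSum_fromBlocks (A : Matrix μ μ F) (hA : A.IsSymm) (hdet : A.det ≠ 0)
    (B : Matrix μ κ F) :
    ∑ D, nondegQuadSum ψ (fromBlocks A B Bᵀ D) = quadSum ψ A * totalQuadSum κ ψ := by
  rw [← Equiv.sum_comp (Equiv.addRight (Bᵀ * A⁻¹ * B)), totalQuadSum, Finset.mul_sum]
  exact Finset.sum_congr rfl fun D _ => nondegQuadSum_fromBlocks ψ A hA hdet B D

/-- A sum over matrices supported on symmetric ones, written in terms of blocks. -/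
theorem sum_eq_sum_fromBlocks {F : Type} [Fintype F] (f : Matrix (μ ⊕ κ) (μ ⊕ κ) F → ℂ)
    (hf : ∀ M, ¬ M.IsSymm → f M = 0) :
    ∑ M, f M = ∑ A, ∑ B, ∑ D, f (fromBlocks A B Bᵀ D) := by
  let e : Matrix μ μ F × Matrix μ κ F × Matrix κ κ F × Matrix κ μ F ≃
      Matrix (μ ⊕ κ) (μ ⊕ κ) F :=
    { toFun := fun p => fromBlocks p.1 p.2.1 p.2.2.2 p.2.2.1
      invFun := fun M => (M.toBlocks₁₁, M.toBlocks₁₂, M.toBlocks₂₂, M.toBlocks₂₁)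
      left_inv := fun p => by simp
      right_inv := fun M => fromBlocks_toBlocks M }
  rw [← e.sum_comp, Fintype.sum_prod_type]
  refine Finset.sum_congr rfl fun A _ => ?_
  rw [Fintype.sum_prod_type]
  refine Finset.sum_congr rfl fun B _ => ?_
  rw [Fintype.sum_prod_type]
  refine Finset.sum_congr rfl fun D _ => ?_
  refine Finset.sum_eq_single Bᵀ (fun C _ hC => hf _ fun h => hC ?_) (by simp)
  exact (isSymm_fromBlocks_iff.1 h).2.1.symm

theorem nondegQuadSum_of_not_isSymm (M : Matrix κ κ F) (hM : ¬ M.IsSymm) :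
    nondegQuadSum ψ M = 0 :=
  if_neg fun h => hM h.1

omit [Field F] in
theorem card_matrix_unit :
    Fintype.card (Matrix Unit κ F) = Fintype.card F ^ Fintype.card κ := by
  rw [Fintype.card_congr (of (m := Unit) (n := κ) (α := F)).symm]
  simp

variable {ψ}

theorem quadSum_scalar (a : F) :
    quadSum ψ (of fun _ _ : Unit => a) = ∑ x : F, ψ (a * (x * x)) := by
  refine Fintype.sum_equiv (Equiv.funUnique Unit F) _ _ fun h => ?_
  simp [dotProduct, mulVec]
  ring_nf

theorem sum_quadSum_scalar (hψ : ψ.IsPrimitive) :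
    ∑ a : F, (if a ≠ 0 then quadSum ψ (of fun _ _ : Unit => a) else 0) = 0 := by
  have h0 : ∑ a : F, ∑ x : F, ψ (a * (x * x)) = Fintype.card F := by
    rw [Finset.sum_comm]
    simp [AddChar.sum_mulShift _ hψ]
  simp only [quadSum_scalar]
  rw [← Finset.sum_filter, Finset.filter_ne', ← Finset.add_sum_erase _ _ (mem_univ (0 : F))] at *
  simpa [sub_eq_zero] using h0

theorem quadSum_fromBlocks_zero (hψ : ψ.IsPrimitive) (h2 : (2 : F) ≠ 0) {b : F} (hb : b ≠ 0)
    (c : F) :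
    quadSum ψ (fromBlocks (of fun _ _ : Unit => 0) (of fun _ _ : Unit => b)
      (of fun _ _ : Unit => b) (of fun _ _ : Unit => c)) = Fintype.card F := by
  unfold quadSum
  rw [← (Equiv.sumArrowEquivProdArrow Unit Unit F).symm.sum_comp,
    ← ((Equiv.funUnique Unit F).prodCongr (Equiv.funUnique Unit F)).symm.sum_comp,
    Fintype.sum_prod_type_right]
  have key (y : F) : ∑ x : F, ψ (c * (y * y)) * ψ (x * (2 * b * y)) =
      if y = 0 then (Fintype.card F : ℂ) else 0 := by
    rw [← Finset.mul_sum, AddChar.sum_mulShift _ hψ]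
    by_cases hy : y = 0 <;> simp [hy, h2, hb]
  rw [← Fintype.sum_ite_eq' (0 : F) (fun _ => (Fintype.card F : ℂ))]
  refine Finset.sum_congr rfl fun y _ => (Finset.sum_congr rfl fun x _ => ?_).trans (key y)
  rw [← AddChar.map_add_eq_mul]
  congr 1
  simp [dotProduct, mulVec]
  ring

theorem totalQuadSum_of_isEmpty [IsEmpty κ] : totalQuadSum κ ψ = 1 := by
  rw [totalQuadSum, Fintype.sum_subsingleton _ 0]
  simp [nondegQuadSum, quadSum]

theorem totalQuadSum_unit (hψ : ψ.IsPrimitive) : totalQuadSum Unit ψ = 0 := by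
  rw [← sum_quadSum_scalar hψ]
  symm
  refine Fintype.sum_equiv ⟨fun a => of fun _ _ : Unit => a, fun M => M () (), fun _ => rfl,
    fun _ => rfl⟩ _ _ fun a => ?_
  have : (of fun _ _ : Unit => a).IsSymm := rfl
  change _ = nondegQuadSum ψ (of fun _ _ : Unit => a)
  simp [nondegQuadSum, this]

/-- The contribution of the symmetric matrices with first row `(0, v)`. -/
noncomputable def borderedSum (ψ : AddChar F ℂ) (v : κ → F) : ℂ :=
  ∑ D : Matrix κ κ F,
    nondegQuadSum ψ (fromBlocks (of fun _ _ : Unit => 0) (replicateRow Unit v)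
      (replicateRow Unit v)ᵀ D)

theorem borderedSum_zero : borderedSum ψ (0 : κ → F) = 0 := by
  refine Finset.sum_eq_zero fun D _ => if_neg fun h => h.2 ?_
  refine det_eq_zero_of_row_eq_zero (Sum.inl ()) fun j => ?_
  cases j <;> simp

theorem borderedSum_comp (e : κ ≃ μ) (v : μ → F) :
    borderedSum ψ (v ∘ e) = borderedSum ψ v := by
  refine Fintype.sum_equiv (reindex e e) _ _ fun D => ?_
  rw [← nondegQuadSum_submatrix ψ ((Equiv.refl Unit).sumCongr e)]
  congr 1
  ext (i | i) (j | j) <;> simp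

theorem borderedSum_of_inl_ne_zero (hψ : ψ.IsPrimitive) (h2 : (2 : F) ≠ 0) (v : Unit ⊕ κ → F)
    (hv : v (Sum.inl ()) ≠ 0) :
    borderedSum ψ v = (Fintype.card F : ℂ) ^ (Fintype.card κ + 2) * totalQuadSum κ ψ := by
  set b := v (Sum.inl ()) with hb
  have hblock (C : Matrix Unit Unit F) (w : Matrix Unit κ F) :
      ∑ E, nondegQuadSum ψ (fromBlocks (of fun _ _ : Unit => 0) (replicateRow Unit v)
        (replicateRow Unit v)ᵀ (fromBlocks C w wᵀ E)) =
      Fintype.card F * totalQuadSum κ ψ := by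
    let A : Matrix (Unit ⊕ Unit) (Unit ⊕ Unit) F := fromBlocks (of fun _ _ => 0)
      (of fun _ _ => b) (of fun _ _ => b) (of fun _ _ => C () ())
    have hA : A.IsSymm := isSymm_fromBlocks_iff.2 ⟨rfl, rfl, rfl, rfl⟩
    have hdet : A.det ≠ 0 := by
      refine (isUnit_det_of_left_inverse (B := fromBlocks (of fun _ _ => -C () () / (b * b))
        (of fun _ _ => b⁻¹) (of fun _ _ => b⁻¹) (of fun _ _ => 0)) ?_).ne_zero
      ext (i | i) (j | j) <;> simp [A, mul_apply, hv]; field_simp; ring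
    rw [← quadSum_fromBlocks_zero hψ h2 hv (C () ()),
      ← sum_nondegQuadSum_fromBlocks ψ A hA hdet (fromRows (of fun _ j => v (Sum.inr j)) w)]
    refine Finset.sum_congr rfl fun E _ => ?_
    rw [← nondegQuadSum_submatrix ψ (Equiv.sumAssoc Unit Unit κ)]
    congr 1
    ext ((i | i) | i) ((j | j) | j) <;> simp [A, hb]
  rw [borderedSum, sum_eq_sum_fromBlocks]
  · simp only [hblock, Finset.sum_const, card_univ, nsmul_eq_mul, card_matrix_unit]
    push_cast
    simp
    ring
  · intro D hD
    exact nondegQuadSum_of_not_isSymm ψ _ fun h => hD (isSymm_fromBlocks_iff.1 h).2.2.2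

theorem borderedSum_of_ne_zero (hψ : ψ.IsPrimitive) (h2 : (2 : F) ≠ 0) (v : Unit ⊕ κ → F)
    (hv : v ≠ 0) :
    borderedSum ψ v = (Fintype.card F : ℂ) ^ (Fintype.card κ + 2) * totalQuadSum κ ψ := by
  obtain ⟨i, hi⟩ := Function.ne_iff.1 hv
  rw [← borderedSum_comp (Equiv.swap i (Sum.inl ())) v]
  refine borderedSum_of_inl_ne_zero hψ h2 _ ?_
  simpa using hi

theorem totalQuadSum_sum_unit (hψ : ψ.IsPrimitive) :
    totalQuadSum (Unit ⊕ κ) ψ = ∑ v : κ → F, borderedSum ψ v := by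
  have hA (a : F) : ∑ B : Matrix Unit κ F, ∑ D,
      nondegQuadSum ψ (fromBlocks (of fun _ _ : Unit => a) B Bᵀ D) =
      (if a ≠ 0 then quadSum ψ (of fun _ _ : Unit => a) else 0) *
        ((Fintype.card F : ℂ) ^ Fintype.card κ * totalQuadSum κ ψ) +
      if a = 0 then ∑ v : κ → F, borderedSum ψ v else 0 := by
    by_cases ha : a = 0
    · subst ha
      simp only [ne_eq, not_true_eq_false, if_false, if_true, zero_mul, zero_add]
      symm
      refine Fintype.sum_equiv ⟨replicateRow Unit, fun M => M (), fun _ => rfl, fun _ => rfl⟩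
        _ _ fun v => rfl
    · have hs : (of fun _ _ : Unit => a).IsSymm := rfl
      simp only [sum_nondegQuadSum_fromBlocks ψ _ hs (by simpa using ha)]
      simp [ha, card_matrix_unit]
      ring
  rw [totalQuadSum, sum_eq_sum_fromBlocks _ (nondegQuadSum_of_not_isSymm ψ)]
  trans ∑ a : F, ∑ B : Matrix Unit κ F, ∑ D,
      nondegQuadSum ψ (fromBlocks (of fun _ _ : Unit => a) B Bᵀ D)
  · symm
    exact Fintype.sum_equiv ⟨fun a => of fun _ _ : Unit => a, fun M => M () (), fun _ => rfl,
      fun _ => rfl⟩ _ _ fun a => rfl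
  · simp only [hA, Finset.sum_add_distrib, ← Finset.sum_mul, sum_quadSum_scalar hψ]
    simp

theorem totalQuadSum_sum_unit_sum_unit (hψ : ψ.IsPrimitive) (h2 : (2 : F) ≠ 0) :
    totalQuadSum (Unit ⊕ (Unit ⊕ κ)) ψ =
      ((Fintype.card F : ℂ) ^ (Fintype.card κ + 1) - 1) *
        ((Fintype.card F : ℂ) ^ (Fintype.card κ + 2) * totalQuadSum κ ψ) := by
  rw [totalQuadSum_sum_unit hψ, ← Finset.add_sum_erase _ _ (mem_univ 0), borderedSum_zero,
    zero_add, Finset.sum_congr rfl fun v hv =>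
      borderedSum_of_ne_zero hψ h2 v (Finset.ne_of_mem_erase hv), Finset.sum_const,
    nsmul_eq_mul, Finset.card_erase_of_mem (mem_univ _), Nat.cast_pred (by simp [Fintype.card_pos])]
  simp [add_comm]

theorem totalQuadSum_fin_add_two (hψ : ψ.IsPrimitive) (h2 : (2 : F) ≠ 0) (n : ℕ) :
    totalQuadSum (Fin (n + 2)) ψ = ((Fintype.card F : ℂ) ^ (n + 1) - 1) *
        ((Fintype.card F : ℂ) ^ (n + 2) * totalQuadSum (Fin n) ψ) := by
  rw [totalQuadSum_congr ψ (Fintype.equivOfCardEq (by simp; omega) :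
    Fin (n + 2) ≃ Unit ⊕ (Unit ⊕ Fin n)), totalQuadSum_sum_unit_sum_unit hψ h2, Fintype.card_fin]

theorem totalQuadSum_fin_odd (hψ : ψ.IsPrimitive) (h2 : (2 : F) ≠ 0) (m : ℕ) :
    totalQuadSum (Fin (2 * m + 1)) ψ = 0 := by
  induction m with
  | zero =>
    rw [totalQuadSum_congr ψ (Fintype.equivOfCardEq (by simp) : Fin (2 * 0 + 1) ≃ Unit),
      totalQuadSum_unit hψ]
  | succ m ih =>
    rw [show 2 * (m + 1) + 1 = 2 * m + 1 + 2 by ring, totalQuadSum_fin_add_two hψ h2, ih]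
    simp

theorem totalQuadSum_fin_even (hψ : ψ.IsPrimitive) (h2 : (2 : F) ≠ 0) (m : ℕ) :
    totalQuadSum (Fin (2 * m)) ψ = (Fintype.card F : ℂ) ^ (m * (m + 1)) *
      ∏ j ∈ Finset.Icc 1 m, ((Fintype.card F : ℂ) ^ (2 * j - 1) - 1) := by
  induction m with
  | zero => simpa using totalQuadSum_of_isEmpty
  | succ m ih =>
    rw [show 2 * (m + 1) = 2 * m + 2 by ring, totalQuadSum_fin_add_two hψ h2, ih,
      Finset.prod_Icc_succ_top (by omega), show 2 * (m + 1) - 1 = 2 * m + 1 by omega]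
    ring

variable (ψ) in
theorem sum_filter_eq_totalQuadSum :
    ∑ B ∈ Finset.univ.filter (fun B : Matrix κ κ F => B.IsSymm ∧ IsUnit B),
      ∑ h : κ → F, ψ (h ⬝ᵥ B.mulVec h) = totalQuadSum κ ψ := by
  rw [Finset.sum_filter]
  refine Finset.sum_congr rfl fun B _ => ?_
  simp only [nondegQuadSum, isUnit_iff_isUnit_det, isUnit_iff_ne_zero]
  rfl

end SymmetricCharacterSums


open Finset Matrix
open scoped Classical

theorem stmt2 {F : Type} [Field F] [Fintype F]
    (r : ℕ) (hr : 0 < r) (hcard : Fintype.card F = 3 ^ r)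
    (ψ : AddChar F ℂ) (hψ : ψ ≠ 1) (r' : ℕ) (hr' : 0 < r') :
    (Even r' →
      ∑ B ∈ Finset.univ.filter
          (fun B : Matrix (Fin r') (Fin r') F => B.IsSymm ∧ IsUnit B),
        ∑ h : Fin r' → F, ψ (h ⬝ᵥ B.mulVec h)
        = (Fintype.card F : ℂ) ^ (r' * (r' + 2) / 4)
            * ∏ j ∈ Finset.Icc 1 (r' / 2), ((Fintype.card F : ℂ) ^ (2 * j - 1) - 1))
    ∧ (Odd r' →
      ∑ B ∈ Finset.univ.filter
          (fun B : Matrix (Fin r') (Fin r') F => B.IsSymm ∧ IsUnit B),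
        ∑ h : Fin r' → F, ψ (h ⬝ᵥ B.mulVec h) = 0) := by
  have hψ' : ψ.IsPrimitive := AddChar.IsPrimitive.of_ne_one hψ
  have h2 : (2 : F) ≠ 0 := by
    refine Ring.two_ne_zero fun h => ?_
    have := FiniteField.even_card_of_char_two h
    rw [hcard] at this
    exact absurd (Nat.even_iff.2 this) (by simp [Nat.not_even_iff_odd, Odd.pow, show Odd 3 by decide])
  simp only [sum_filter_eq_totalQuadSum]
  constructor
  · rintro ⟨m, rfl⟩
    rw [← two_mul, totalQuadSum_fin_even hψ' h2, Nat.mul_div_cancel_left _ (by norm_num),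
      show 2 * m * (2 * m + 2) = 4 * (m * (m + 1)) by ring, Nat.mul_div_cancel_left _ (by norm_num)]
  · rintro ⟨m, rfl⟩
    exact totalQuadSum_fin_odd hψ' h2 m
end
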